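/- Let K be a field, m ≥ 3 and n ≥ 2m integers, k = ⌊(n+1)/(m+1)⌋, and a = n+1 − k(m+1). Then the colon ideal L_k = (I_{n,m} : x_m x_{2m+1} ⋯ x_{k(m+1)−1}) (colon by ∏_{l=1}^{k} x_{l(m+1)−1}) equals the ideal of S generated by: for each 0 ≤ l ≤ k−2, the monomials u_i / x_{(l+1)(m+1)−1} for l(m+1)+1 ≤ i ≤ (l+1)(m+1)−1, together with the monomials u_i / x_{k(m+1)−1} for (k−1)(m+1)+1 ≤ i ≤ t, where t = n−m if a = m and t = n−m+1 otherwise. Moreover this generating set has t+1−k elements. -/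

import Mathlib

open MvPolynomial

/-- The generator `u_i = x_i x_{i+1} ⋯ x_{i+m-1}` of the path ideal, where the
variables of `K[x_1,…,x_n]` are 1-indexed via `x_t = X ⟨t-1⟩`. -/
noncomputable def pathGen (K : Type) [Field K] (n m i : ℕ) : MvPolynomial (Fin n) K :=
  ∏ j ∈ Finset.univ.filter (fun j : Fin n => i ≤ (j : ℕ) + 1 ∧ (j : ℕ) + 1 < i + m),
    X j

/-- The monomial `u_i / x_p = ∏_{i ≤ l ≤ i+m-1, l ≠ p} x_l`. -/
noncomputable def pathGenDiv (K : Type) [Field K] (n m i p : ℕ) : MvPolynomial (Fin n) K :=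
  ∏ j ∈ Finset.univ.filter
      (fun j : Fin n => (i ≤ (j : ℕ) + 1 ∧ (j : ℕ) + 1 < i + m) ∧ (j : ℕ) + 1 ≠ p),
    X j

/-- The path ideal `I_{n,m} = (u_1, …, u_{n-m+1}) ⊆ K[x_1,…,x_n]` of the line graph. -/
noncomputable def pathIdeal (K : Type) [Field K] (n m : ℕ) : Ideal (MvPolynomial (Fin n) K) :=
  Ideal.span {q | ∃ i : ℕ, 1 ≤ i ∧ i ≤ n - m + 1 ∧ q = pathGen K n m i}

/-- The variable `x_t` of `K[x_1,…,x_n]` (1-indexed; junk value `0` out of range). -/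
noncomputable def xv (K : Type) [Field K] (n t : ℕ) : MvPolynomial (Fin n) K :=
  if h : 1 ≤ t ∧ t ≤ n then X (⟨t - 1, by omega⟩ : Fin n) else 0

/-- A product of distinct variables is a monomial with coefficient one. -/
lemma prod_X_eq_monomial (K : Type) [Field K] {n : ℕ} (A : Finset (Fin n)) :
    (∏ j ∈ A, X j : MvPolynomial (Fin n) K) = monomial (∑ j ∈ A, Finsupp.single j 1) 1 := by
  rw [monomial_sum_one]
  rfl

lemma sum_single_one_apply {n : ℕ} (A : Finset (Fin n)) (i : Fin n) :
    (∑ j ∈ A, Finsupp.single j 1 : Fin n →₀ ℕ) i = if i ∈ A then 1 else 0 := by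
  classical
  simp [Finsupp.finsetSum_apply, Finsupp.single_apply]

/-- The colon of an ideal generated by squarefree monomials by a squarefree monomial, when the
candidate generators `B` satisfy the two evident support conditions. -/
lemma colon_span_squarefree (K : Type) [Field K] {n : ℕ} (𝒜 ℬ : Set (Finset (Fin n)))
    (P : Finset (Fin n))
    (h₁ : ∀ B ∈ ℬ, ∃ A ∈ 𝒜, A ⊆ B ∪ P)
    (h₂ : ∀ A ∈ 𝒜, ∃ B ∈ ℬ, B ⊆ A \ P) :
    (Ideal.span ((fun A => (∏ j ∈ A, X j : MvPolynomial (Fin n) K)) '' 𝒜)).colon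
        (Ideal.span {(∏ j ∈ P, X j : MvPolynomial (Fin n) K)}) =
      Ideal.span ((fun B => (∏ j ∈ B, X j : MvPolynomial (Fin n) K)) '' ℬ) := by
  classical
  apply le_antisymm
  · intro r hr
    rw [Ideal.mem_colon_span_singleton] at hr
    simp only [prod_X_eq_monomial] at hr ⊢
    have e : ∀ 𝒞 : Set (Finset (Fin n)),
        (fun A => (monomial (∑ j ∈ A, Finsupp.single j 1) 1 : MvPolynomial (Fin n) K)) '' 𝒞 =
        (fun s => monomial s (1 : K)) '' ((fun A => ∑ j ∈ A, Finsupp.single j 1) '' 𝒞) := by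
      intro 𝒞
      rw [Set.image_image]
    rw [e, mem_ideal_span_monomial_image] at hr ⊢
    intro x hx
    obtain ⟨_, ⟨A, hA, rfl⟩, hle⟩ := hr (x + ∑ j ∈ P, Finsupp.single j 1) (by
      rw [mem_support_iff, coeff_mul_monomial, mul_one]
      exact mem_support_iff.1 hx)
    obtain ⟨B, hB, hBA⟩ := h₂ A hA
    refine ⟨_, ⟨B, hB, rfl⟩, fun i => ?_⟩
    have := hle i
    simp only [Finsupp.add_apply, sum_single_one_apply] at this ⊢
    by_cases hi : i ∈ B
    · have h := Finset.mem_sdiff.1 (hBA hi)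
      simpa [hi, h.1, h.2] using this
    · simp [hi]
  · rw [Ideal.span_le]
    rintro _ ⟨B, hB, rfl⟩
    obtain ⟨A, hA, hAB⟩ := h₁ B hB
    simp only [SetLike.mem_coe]
    rw [Ideal.mem_colon_span_singleton]
    refine Ideal.mem_of_dvd _ ?_ (Ideal.subset_span ⟨A, hA, rfl⟩)
    refine (Finset.prod_dvd_prod_of_subset _ _ _ hAB).trans ?_
    rw [← Finset.prod_union_inter]
    exact dvd_mul_right _ _

/-- Products of distinct variables determine their support. -/
lemma prod_X_injective (K : Type) [Field K] {n : ℕ} :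
    Function.Injective (fun A : Finset (Fin n) => (∏ j ∈ A, X j : MvPolynomial (Fin n) K)) := by
  intro A B h
  simp only [prod_X_eq_monomial] at h
  have h' := monomial_left_injective (one_ne_zero (α := K)) h
  ext i
  have := DFunLike.congr_fun h' i
  simp only [sum_single_one_apply] at this
  by_cases hA : i ∈ A <;> by_cases hB : i ∈ B <;> simp_all

/-- The (zero-based) support of `u_i`. -/
def pathWindow (n m i : ℕ) : Finset (Fin n) :=
  Finset.univ.filter (fun j : Fin n => i ≤ (j : ℕ) + 1 ∧ (j : ℕ) + 1 < i + m)

/-- The (zero-based) support of `u_i / x_p`. -/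
def pathWindowErase (n m i p : ℕ) : Finset (Fin n) :=
  Finset.univ.filter
    (fun j : Fin n => (i ≤ (j : ℕ) + 1 ∧ (j : ℕ) + 1 < i + m) ∧ (j : ℕ) + 1 ≠ p)

/-- The (zero-based) positions `l(m+1)-1`, `l ≥ 1`. -/
def colonSupport (n m : ℕ) : Finset (Fin n) :=
  Finset.univ.filter (fun j : Fin n => (m + 1) ∣ (j : ℕ) + 2)

lemma prod_xv_eq (K : Type) [Field K] (n m : ℕ) (hm : 1 ≤ m) :
    ∏ l ∈ Finset.Icc 1 ((n + 1) / (m + 1)), xv K n (l * (m + 1) - 1) =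
      ∏ j ∈ colonSupport n m, X j := by
  symm
  refine Finset.prod_nbij (fun j : Fin n => ((j : ℕ) + 2) / (m + 1)) ?_ ?_ ?_ ?_
  · intro j hj
    have hd : (m + 1) ∣ (j : ℕ) + 2 := by simpa [colonSupport] using hj
    rw [Finset.mem_Icc]
    exact ⟨Nat.div_pos (Nat.le_of_dvd (by omega) hd) (by omega),
      Nat.div_le_div_right (by omega)⟩
  · intro i hi j hj hij
    have hi' : (m + 1) ∣ (i : ℕ) + 2 := by simpa [colonSupport] using hi
    have hj' : (m + 1) ∣ (j : ℕ) + 2 := by simpa [colonSupport] using hj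
    have h := Nat.div_mul_cancel hi'
    have h' := Nat.div_mul_cancel hj'
    dsimp only at hij
    rw [hij] at h
    ext
    omega
  · intro l hl
    have hl' := Finset.mem_Icc.1 (Finset.mem_coe.1 hl)
    have h1 : l * (m + 1) ≤ n + 1 := (Nat.le_div_iff_mul_le (by omega)).1 hl'.2
    have h2 : 1 * (m + 1) ≤ l * (m + 1) := Nat.mul_le_mul_right _ hl'.1
    refine ⟨⟨l * (m + 1) - 2, by omega⟩, ?_, ?_⟩
    · have : l * (m + 1) - 2 + 2 = l * (m + 1) := by omega
      simp [colonSupport, this]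
    · have : l * (m + 1) - 2 + 2 = l * (m + 1) := by omega
      simp [this]
  · intro j hj
    have hd : (m + 1) ∣ (j : ℕ) + 2 := by simpa [colonSupport] using hj
    have hj' := j.2
    have h : ((j : ℕ) + 2) / (m + 1) * (m + 1) = (j : ℕ) + 2 := Nat.div_mul_cancel hd
    rw [xv, dif_pos (by rw [h]; omega)]
    congr 1
    ext
    simp only [h]
    omega

/-- The index set of the generators `u_i / x_p`: positions up to `t` not divisible by `m+1`. -/
def pathIndex (m t : ℕ) : Finset ℕ := (Finset.Ioc 0 t).filter (fun i => ¬ (m + 1) ∣ i)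

lemma card_pathIndex (m t : ℕ) : (pathIndex m t).card = t - t / (m + 1) := by
  have h := Finset.card_filter_add_card_filter_not (s := Finset.Ioc 0 t) (fun i => (m + 1) ∣ i)
  rw [Nat.Ioc_filter_dvd_card_eq_div, Nat.card_Ioc] at h
  rw [pathIndex]
  omega

/-- The position erased from the window starting at `i`. -/
def erasedPos (m i : ℕ) : ℕ := (i / (m + 1) + 1) * (m + 1) - 1

lemma mem_pathIndex_iff (m t i : ℕ) :
    i ∈ pathIndex m t ↔ i ≤ t ∧ ∃ l, l * (m + 1) + 1 ≤ i ∧ i ≤ l * (m + 1) + m := by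
  simp only [pathIndex, Finset.mem_filter, Finset.mem_Ioc]
  constructor
  · rintro ⟨⟨_, h⟩, hd⟩
    refine ⟨h, i / (m + 1), ?_⟩
    have h1 := Nat.div_add_mod' i (m + 1)
    have h2 := Nat.mod_lt i (Nat.succ_pos m)
    have h3 : i % (m + 1) ≠ 0 := fun h => hd (Nat.dvd_of_mod_eq_zero h)
    simp only [Nat.succ_eq_add_one] at h2
    omega
  · rintro ⟨h, l, h1, h2⟩
    refine ⟨⟨by omega, h⟩, ?_⟩
    rintro ⟨c, rfl⟩
    rw [mul_comm (m + 1)] at h1 h2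
    have h3 : l < c := by
      by_contra hc
      have := Nat.mul_le_mul_right (m + 1) (not_lt.1 hc)
      omega
    have := Nat.mul_le_mul_right (m + 1) (Nat.succ_le_of_lt h3)
    rw [Nat.succ_mul] at this
    omega

lemma erasedPos_eq {m i l : ℕ} (h1 : l * (m + 1) + 1 ≤ i) (h2 : i ≤ l * (m + 1) + m) :
    erasedPos m i = (l + 1) * (m + 1) - 1 := by
  have : i / (m + 1) = l := by
    rw [Nat.div_eq_iff (by omega)]
    omega
  rw [erasedPos, this]

/-- Within a window starting strictly between consecutive multiples of `m+1`, only the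
erased position lies in `colonSupport`. -/
lemma dvd_add_two_iff {m i j l : ℕ} (h1 : l * (m + 1) + 1 ≤ i) (h2 : i ≤ l * (m + 1) + m)
    (h3 : i ≤ j + 1) (h4 : j + 1 < i + m) :
    (m + 1) ∣ j + 2 ↔ j + 1 = (l + 1) * (m + 1) - 1 := by
  have e : (l + 1) * (m + 1) = l * (m + 1) + m + 1 := by ring
  constructor
  · rintro ⟨c, hc⟩
    rw [mul_comm] at hc
    have hlc : l < c := by
      by_contra hh
      have := Nat.mul_le_mul_right (m + 1) (not_lt.1 hh)
      omega
    have hcl : c < l + 2 := by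
      by_contra hh
      have := Nat.mul_le_mul_right (m + 1) (not_lt.1 hh)
      have e' : (l + 2) * (m + 1) = l * (m + 1) + m + 1 + m + 1 := by ring
      omega
    obtain rfl : c = l + 1 := by omega
    omega
  · intro h
    exact ⟨l + 1, by rw [mul_comm]; omega⟩

lemma pathWindowErase_injOn {n m t : ℕ} (hm : 2 ≤ m) (ht : t + m ≤ n + 1) :
    Set.InjOn (fun i => pathWindowErase n m i (erasedPos m i)) (pathIndex m t) := by
  have key : ∀ i ∈ pathIndex m t, ∀ i' ∈ pathIndex m t, i < i' →
      pathWindowErase n m i (erasedPos m i) ≠ pathWindowErase n m i' (erasedPos m i') := by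
    intro i hi i' hi' hlt heq
    obtain ⟨hit, l, h1, h2⟩ := (mem_pathIndex_iff m t i).1 hi
    have hd := (Finset.mem_filter.1 hi').2
    have e : (l + 1) * (m + 1) = l * (m + 1) + m + 1 := by ring
    rw [erasedPos_eq h1 h2] at heq
    rw [Finset.ext_iff] at heq
    simp only [pathWindowErase, Finset.mem_filter, Finset.mem_univ, true_and] at heq
    by_cases hp : i = l * (m + 1) + m
    · have hne : i' ≠ i + 1 := by
        rintro rfl
        exact hd ⟨l + 1, by rw [mul_comm (m + 1)]; omega⟩
      have := (heq ⟨i, by omega⟩).1 (by dsimp only; omega)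
      dsimp only at this
      omega
    · have := (heq ⟨i - 1, by omega⟩).1 (by dsimp only; omega)
      dsimp only at this
      omega
  intro i hi i' hi' h
  rcases lt_trichotomy i i' with hlt | heq | hgt
  · exact absurd h (key i hi i' hi' hlt)
  on_goal 2 => exact absurd h.symm (key i' hi' i hi hgt)
  exact heq

/-- For `m ≥ 3`, `n ≥ 2m`, `k = ⌊(n+1)/(m+1)⌋` and `a = n+1-k(m+1)`, the colon ideal
`L_k = (I_{n,m} : x_m x_{2m+1} ⋯ x_{k(m+1)-1})` is generated by the monomials
`u_i / x_{(l+1)(m+1)-1}` for `0 ≤ l ≤ k-2` and `l(m+1)+1 ≤ i ≤ (l+1)(m+1)-1`, together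
with the monomials `u_i / x_{k(m+1)-1}` for `(k-1)(m+1)+1 ≤ i ≤ t`, where `t = n-m` if
`a = m` and `t = n-m+1` otherwise; moreover this generating set has `t+1-k` elements. -/
theorem stmt_10 (K : Type) [Field K] (n m : ℕ) (hm : 3 ≤ m) (hn : 2 * m ≤ n)
    (k : ℕ) (hk : k = (n + 1) / (m + 1)) (a : ℕ) (ha : a = n + 1 - k * (m + 1))
    (t : ℕ) (ht : t = if a = m then n - m else n - m + 1)
    (G : Set (MvPolynomial (Fin n) K))
    (hG : G = {q | ∃ l i : ℕ, l + 2 ≤ k ∧ l * (m + 1) + 1 ≤ i ∧ i ≤ (l + 1) * (m + 1) - 1 ∧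
          q = pathGenDiv K n m i ((l + 1) * (m + 1) - 1)} ∪
        {q | ∃ i : ℕ, (k - 1) * (m + 1) + 1 ≤ i ∧ i ≤ t ∧
          q = pathGenDiv K n m i (k * (m + 1) - 1)}) :
    (pathIdeal K n m).colon
        (Ideal.span {∏ l ∈ Finset.Icc 1 k, xv K n (l * (m + 1) - 1)}) =
      Ideal.span G ∧
    G.ncard = t + 1 - k := by
  have hb := Nat.div_add_mod' (n + 1) (m + 1)
  have hmod := Nat.mod_lt (n + 1) (Nat.succ_pos m)
  rw [← hk] at hb
  simp only [Nat.succ_eq_add_one] at hmod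
  have hna : n + 1 = k * (m + 1) + a := by omega
  have ham : a ≤ m := by omega
  have hk1 : 1 ≤ k := by
    rw [hk]
    exact Nat.div_pos (by omega) (by omega)
  obtain ⟨c, rfl⟩ : ∃ c, k = c + 1 := ⟨k - 1, by omega⟩
  have ec : (c + 1) * (m + 1) = c * (m + 1) + m + 1 := by ring
  have htb : c * (m + 1) + 1 ≤ t ∧ t ≤ c * (m + 1) + m ∧ t + m ≤ n + 1 ∧
      (t = n - m + 1 ∨ (t = n - m ∧ t = c * (m + 1) + m)) := by
    split_ifs at ht <;> omega
  obtain ⟨ht1, ht2, ht3, ht4⟩ := htb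
  have hGi : G = (fun B : Finset (Fin n) => (∏ j ∈ B, X j : MvPolynomial (Fin n) K)) ''
      ((fun i => pathWindowErase n m i (erasedPos m i)) '' (pathIndex m t)) := by
    rw [hG, Set.image_image]
    ext q
    simp only [Set.mem_union, Set.mem_ofPred_eq, Set.mem_image, Finset.mem_coe]
    constructor
    · rintro (⟨l, i, hl, h1, h2, rfl⟩ | ⟨i, h1, h2, rfl⟩)
      · have el : (l + 1) * (m + 1) = l * (m + 1) + m + 1 := by ring
        have hlc := Nat.mul_le_mul_right (m + 1) (show l + 1 ≤ c by omega)
        refine ⟨i, (mem_pathIndex_iff m t i).2 ⟨by omega, l, h1, by omega⟩, ?_⟩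
        rw [erasedPos_eq h1 (by omega)]
        rfl
      · simp only [Nat.add_sub_cancel] at h1
        refine ⟨i, (mem_pathIndex_iff m t i).2 ⟨h2, c, h1, by omega⟩, ?_⟩
        rw [erasedPos_eq h1 (by omega)]
        rfl
    · rintro ⟨i, hi, rfl⟩
      obtain ⟨hit, l, h1, h2⟩ := (mem_pathIndex_iff m t i).1 hi
      have el : (l + 1) * (m + 1) = l * (m + 1) + m + 1 := by ring
      rw [erasedPos_eq h1 h2]
      have hlc : l ≤ c := by
        by_contra hh
        have := Nat.mul_le_mul_right (m + 1) (show c + 1 ≤ l by omega)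
        omega
      rcases hlc.lt_or_eq with hlt | rfl
      · exact Or.inl ⟨l, i, by omega, h1, by omega, rfl⟩
      · exact Or.inr ⟨i, by simpa using h1, hit, rfl⟩
  have hI : pathIdeal K n m =
      Ideal.span ((fun A : Finset (Fin n) => (∏ j ∈ A, X j : MvPolynomial (Fin n) K)) ''
        (pathWindow n m '' Set.Icc 1 (n - m + 1))) := by
    rw [pathIdeal, Set.image_image]
    congr 1
    ext q
    constructor
    · rintro ⟨i, h1, h2, rfl⟩
      exact ⟨i, ⟨h1, h2⟩, rfl⟩
    · rintro ⟨i, ⟨h1, h2⟩, rfl⟩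
      exact ⟨i, h1, h2, rfl⟩
  constructor
  · rw [hI, hGi, hk, prod_xv_eq K n m (by omega)]
    apply colon_span_squarefree
    · rintro _ ⟨i, hi, rfl⟩
      obtain ⟨hit, l, h1, h2⟩ := (mem_pathIndex_iff m t i).1 hi
      refine ⟨_, ⟨i, ⟨by omega, by omega⟩, rfl⟩, fun j hj => ?_⟩
      simp only [pathWindow, pathWindowErase, colonSupport, Finset.mem_union, Finset.mem_filter,
        Finset.mem_univ, true_and] at hj ⊢
      rw [dvd_add_two_iff h1 h2 hj.1 hj.2, erasedPos_eq h1 h2]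
      tauto
    · rintro _ ⟨i, ⟨hi1, hi2⟩, rfl⟩
      -- it suffices to find a generator whose support lies in the window at `i`
      suffices h : ∃ i' ≤ t, ∃ l, (l * (m + 1) + 1 ≤ i' ∧ i' ≤ l * (m + 1) + m) ∧
          ∀ j, (i' ≤ j + 1 ∧ j + 1 < i' + m) → j + 1 ≠ (l + 1) * (m + 1) - 1 →
            i ≤ j + 1 ∧ j + 1 < i + m by
        obtain ⟨i', hi', l, ⟨h1, h2⟩, h3⟩ := h
        refine ⟨_, ⟨i', (mem_pathIndex_iff m t i').2 ⟨hi', l, h1, h2⟩, rfl⟩, fun j hj => ?_⟩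
        simp only [pathWindow, pathWindowErase, colonSupport, Finset.mem_sdiff,
          Finset.mem_filter, Finset.mem_univ, true_and, erasedPos_eq h1 h2] at hj ⊢
        rw [dvd_add_two_iff h1 h2 hj.1.1 hj.1.2]
        exact ⟨h3 j hj.1 hj.2, hj.2⟩
      by_cases hit : i ≤ t
      · by_cases hd : (m + 1) ∣ i
        · obtain ⟨l, rfl⟩ := hd
          rw [mul_comm (m + 1)] at *
          have el : (l + 1) * (m + 1) = l * (m + 1) + m + 1 := by ring
          have hlc : l ≤ c := by
            by_contra hh
            have := Nat.mul_le_mul_right (m + 1) (show c + 1 ≤ l by omega)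
            omega
          have := Nat.mul_le_mul_right (m + 1) hlc
          exact ⟨l * (m + 1) + 1, by omega, l, by omega, fun j _ _ => by omega⟩
        · obtain ⟨-, l, h1, h2⟩ := (mem_pathIndex_iff m t i).1
            (Finset.mem_filter.2 ⟨Finset.mem_Ioc.2 ⟨hi1, hit⟩, hd⟩)
          exact ⟨i, hit, l, ⟨h1, h2⟩, fun j h _ => h⟩
      · exact ⟨t, le_rfl, c, ⟨ht1, ht2⟩, fun j _ _ => by omega⟩
  · rw [hGi, Set.ncard_image_of_injective _ (prod_X_injective K),
      (pathWindowErase_injOn (by omega) ht3).ncard_image, Set.ncard_coe_finset,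
      card_pathIndex]
    have : t / (m + 1) = c := by
      rw [Nat.div_eq_iff (by omega)]
      omega
    omega
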